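/- Let X ⊂ P^r be an integral nondegenerate projective variety of type A (meaning Γ_o(X) = Γ_q(X) for general o in ⟨Γ_q(X)⟩ and general q ∈ P^r). Then the generic rank of X equals the generic rank of its general entry locus Γ_q(X): r_gen(X) = r_gen(Γ_q(X)). -/

import Mathlib

open MvPolynomial

noncomputable section

namespace EL

variable {k : Type} [Field k] {n : ℕ}

/-- Projective space of (vector) dimension `n` over `k`. -/
abbrev PS (k : Type) [Field k] (n : ℕ) : Type := Projectivization k (Fin n → k)

/-- Projective vanishing set of a polynomial (intended to be homogeneous). -/
def V0 (f : MvPolynomial (Fin n) k) : Set (PS k n) :=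
  {p | ∀ (v : Fin n → k) (hv : v ≠ 0), Projectivization.mk k v hv = p → eval v f = 0}

/-- The Zariski topology on projective space, generated by complements of vanishing
sets of homogeneous polynomials. -/
instance : TopologicalSpace (PS k n) :=
  TopologicalSpace.generateFrom
    {U | ∃ (d : ℕ) (f : MvPolynomial (Fin n) k), f.IsHomogeneous d ∧ U = (V0 f)ᶜ}

/-- The linear span (as a submodule of the cone) of a set of projective points. -/
def pspan (S : Set (PS k n)) : Submodule k (Fin n → k) := ⨆ p ∈ S, p.submodule

/-- The projective linear subspace associated to a submodule. -/
def linSet (W : Submodule k (Fin n → k)) : Set (PS k n) := {p | p.submodule ≤ W}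

/-- `q` lies in the projective span of `S`. -/
def memSpan (q : PS k n) (S : Set (PS k n)) : Prop := q.submodule ≤ pspan S

/-- The projective dimension of the span of `S`. -/
def spanDim (S : Set (PS k n)) : ℕ := Module.finrank k ↥(pspan S) - 1

/-- `S` is nondegenerate (spans the ambient projective space). -/
def Nondeg (S : Set (PS k n)) : Prop := pspan S = ⊤

/-- `S` is a projective linear subspace of projective dimension `d`. -/
def IsLin (S : Set (PS k n)) (d : ℕ) : Prop :=
  ∃ W : Submodule k (Fin n → k), Module.finrank k ↥W = d + 1 ∧ S = linSet W

/-- Dimension of a subset, as topological Krull dimension. -/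
def pdim (S : Set (PS k n)) : WithBot ℕ∞ := topologicalKrullDim ↥S

/-- An integral (sub)variety: an irreducible Zariski-closed set. -/
def IsVariety (S : Set (PS k n)) : Prop := IsClosed S ∧ IsIrreducible S

/-- A property holds for a general point of projective space. -/
def Generic (P : PS k n → Prop) : Prop :=
  ∃ U : Set (PS k n), IsOpen U ∧ Dense U ∧ ∀ q ∈ U, P q

/-- A property holds for a general point of the set `S`. -/
def GenericIn (S : Set (PS k n)) (P : PS k n → Prop) : Prop :=
  ∃ U : Set (PS k n), IsOpen U ∧ S ⊆ closure (S ∩ U) ∧ ∀ q ∈ S ∩ U, P q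

/-- A property holds for a general tuple of points of projective space. -/
def GenericP {ι : Type} (P : (ι → PS k n) → Prop) : Prop :=
  ∃ U : Set (ι → PS k n), IsOpen U ∧ Dense U ∧ ∀ z ∈ U, P z

/-- `q` is spanned by some `s` points of `X`. -/
def hasDecomp (X : Set (PS k n)) (q : PS k n) (s : ℕ) : Prop :=
  ∃ A : Finset (PS k n), ↑A ⊆ X ∧ A.card = s ∧ memSpan q ↑A

/-- The `X`-rank of a point `q`. -/
def rk (X : Set (PS k n)) (q : PS k n) : ℕ := sInf {s | hasDecomp X q s}

/-- `A` irredundantly spans `q`. -/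
def Irredundant (q : PS k n) (A : Finset (PS k n)) : Prop :=
  memSpan q ↑A ∧ ∀ B : Finset (PS k n), B ⊂ A → ¬ memSpan q ↑B

/-- The set `𝒮(X,q)` of minimal irredundant decompositions of `q` by points of `X`. -/
def decomps (X : Set (PS k n)) (q : PS k n) : Set (Finset (PS k n)) :=
  {A | ↑A ⊆ X ∧ A.card = rk X q ∧ Irredundant q A}

/-- The entry locus of `q` with respect to `X`. -/
def entryLocus (X : Set (PS k n)) (q : PS k n) : Set (PS k n) :=
  closure (⋃ A ∈ decomps X q, (↑A : Set (PS k n)))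

/-- The `s`-th secant variety of `X`. -/
def secant (X : Set (PS k n)) (s : ℕ) : Set (PS k n) :=
  closure {q | hasDecomp X q s}

/-- The generic `X`-rank: least `s` whose secant fills the span of `X`. -/
def rgen (X : Set (PS k n)) : ℕ := sInf {s | secant X s = linSet (pspan X)}

/-- Type I: the general entry locus is irreducible. -/
def TypeI (X : Set (PS k n)) : Prop := Generic (fun q => IsIrreducible (entryLocus X q))

/-- Type II: the general entry locus is reducible. -/
def TypeII (X : Set (PS k n)) : Prop := Generic (fun q => ¬ IsIrreducible (entryLocus X q))

/-- Type A: the entry locus does not change at a general point of its span. -/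
def TypeA (X : Set (PS k n)) : Prop :=
  Generic (fun q => GenericIn (linSet (pspan (entryLocus X q)))
    (fun o => entryLocus X o = entryLocus X q))

/-- `S` (of dimension `m`) has degree `d`: `d` is the largest finite number of points cut
on `S` by a linear subspace of complementary dimension. -/
def HasDegree (S : Set (PS k n)) (m d : ℕ) : Prop :=
  IsGreatest {t | ∃ L : Set (PS k n), IsLin L (n - 1 - m) ∧ (S ∩ L).Finite ∧
    (S ∩ L).ncard = t} d

/-- All secant varieties of `Y` (of dimension `m`) have the expected dimension. -/
def NonDefective (Y : Set (PS k n)) (m : ℕ) : Prop :=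
  ∀ s : ℕ, 1 ≤ s →
    pdim (secant Y s) = ((min ((m+1)*s - 1) (spanDim Y) : ℕ) : WithBot ℕ∞)

/-- `π_o(T) ⊆ π_o(Y)`: every point of `T` (other than `o`) is collinear with `o`
and a point of `Y`. -/
def projLE (o : PS k n) (T Y : Set (PS k n)) : Prop :=
  ∀ t ∈ T, t ≠ o → ∃ y ∈ Y, t.submodule ≤ o.submodule ⊔ y.submodule

/-- A Segre point of the pair `(Y,T)`: projection from `o` maps `Y` and `T`
onto the same set. -/
def SegrePtPair (Y T : Set (PS k n)) (o : PS k n) : Prop :=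
  o ∉ Y ∪ T ∧ projLE o Y T ∧ projLE o T Y

/-- A Segre point of `Y`: the projection from `o` is non-birational on `Y`
(it is not generically injective). -/
def SegrePt (Y : Set (PS k n)) (o : PS k n) : Prop :=
  o ∉ Y ∧ ¬ GenericIn Y (fun y => ∀ y' ∈ Y, y'.submodule ≤ o.submodule ⊔ y.submodule → y' = y)

/-- The Segre locus of `Y`. -/
def segreLocus (Y : Set (PS k n)) : Set (PS k n) := closure {o | SegrePt Y o}

/-- `X` is a cone with vertex `v`. -/
def IsCone (X : Set (PS k n)) (v : PS k n) : Prop :=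
  ∀ p ∈ X, ∀ q : PS k n, q.submodule ≤ v.submodule ⊔ p.submodule → q ∈ X

/-- The homogeneous polynomials vanishing on `X`. -/
def homogCut (X : Set (PS k n)) : Set (MvPolynomial (Fin n) k) :=
  {f | (∃ d, f.IsHomogeneous d) ∧ X ⊆ V0 f}

/-- The span of the gradients at `p` of homogeneous polynomials vanishing on `X`. -/
def gradSpan (X : Set (PS k n)) (p : PS k n) : Submodule k (Fin n → k) :=
  Submodule.span k ((fun f => fun i => eval p.rep (pderiv i f)) '' homogCut X)

/-- Smoothness at a point of an `m`-dimensional subvariety (Jacobian criterion). -/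
def IsSmoothPt (X : Set (PS k n)) (m : ℕ) (p : PS k n) : Prop :=
  Module.finrank k ↥(gradSpan X p) = n - (m + 1)

/-- `X` (of dimension `m`) has only isolated singularities. -/
def IsolatedSings (X : Set (PS k n)) (m : ℕ) : Prop :=
  {p ∈ X | ¬ IsSmoothPt X m p}.Finite

/-- `X` (of dimension `m`) is smooth. -/
def IsSmoothVar (X : Set (PS k n)) (m : ℕ) : Prop := ∀ p ∈ X, IsSmoothPt X m p

/-- The hyperplane (as a submodule) determined by a point of the dual projective space. -/
def hypSub (a : PS k n) : Submodule k (Fin n → k) :=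
  LinearMap.ker (∑ i, a.rep i • (LinearMap.proj i : (Fin n → k) →ₗ[k] k))

/-- The hyperplane determined by a point of the dual projective space. -/
def hypOf (a : PS k n) : Set (PS k n) := linSet (hypSub a)

/-- The (geometric) genus of a space curve `C`, defined by the node count of a
projection from a general point of its span: a general point of `⟨C⟩` lies on
`(d-1)(d-2)/2 - g` secant lines of `C`. -/
def HasGenus (C : Set (PS k n)) (g : ℕ) : Prop :=
  ∃ d : ℕ, HasDegree C 1 d ∧
    GenericIn (linSet (pspan C)) (fun q =>
      2 * (decomps C q).ncard + 2 * g + 3 * d = d * d + 2)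

/-- The embedded tangent space of `X` at `p` (as a submodule of the cone). -/
def tangentSub (X : Set (PS k n)) (p : PS k n) : Submodule k (Fin n → k) :=
  ⨅ f ∈ homogCut X,
    LinearMap.ker (∑ i, (eval p.rep (pderiv i f)) • (LinearMap.proj i : (Fin n → k) →ₗ[k] k))

/-- A curve is tangentially degenerate if its general tangent line meets the
curve elsewhere. -/
def TangDeg (X : Set (PS k n)) : Prop :=
  GenericIn {p ∈ X | IsSmoothPt X 1 p}
    (fun p => ∃ y ∈ X, y ≠ p ∧ y.submodule ≤ tangentSub X p)

/-- The homogeneous ideal of `X`. -/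
def projIdeal (X : Set (PS k n)) : Ideal (MvPolynomial (Fin n) k) :=
  Ideal.span {f | X ⊆ V0 f}

/-- `X` is a normal variety: its homogeneous coordinate ring is integrally closed
in its total fraction ring. -/
def IsNormalVar (X : Set (PS k n)) : Prop :=
  ∀ x : FractionRing (MvPolynomial (Fin n) k ⧸ projIdeal X),
    IsIntegral (MvPolynomial (Fin n) k ⧸ projIdeal X) x →
      ∃ y : MvPolynomial (Fin n) k ⧸ projIdeal X,
        algebraMap (MvPolynomial (Fin n) k ⧸ projIdeal X)
          (FractionRing (MvPolynomial (Fin n) k ⧸ projIdeal X)) y = x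

/-- `C` is an irreducible component of `Y`. -/
def IsCompOf (C Y : Set (PS k n)) : Prop :=
  Maximal (fun Z => Z ⊆ Y ∧ IsIrreducible Z) C

/-- The image of `X` under the linear projection from (the linear space of) `W`,
realized inside the complementary linear space of `Λ`. -/
def projFrom (W Λ : Submodule k (Fin n → k)) (X : Set (PS k n)) : Set (PS k n) :=
  {y | y.submodule ≤ Λ ∧ ∃ x ∈ X, y.submodule ≤ W ⊔ x.submodule}

/-- Decompositions of `q` as irredundant spans of one point from each `Xs i`. -/
def tupleDecomps {s : ℕ} (Xs : Fin s → Set (PS k n)) (q : PS k n) :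
    Set (Fin s → PS k n) :=
  {p | (∀ i, p i ∈ Xs i) ∧ Function.Injective p ∧ memSpan q (Set.range p) ∧
    ∀ i, ¬ memSpan q (Set.range p \ {p i})}

/-- The entry locus of `q` with respect to the tuple of varieties `Xs`. -/
def entryLocusT {s : ℕ} (Xs : Fin s → Set (PS k n)) (q : PS k n) : Set (PS k n) :=
  closure (⋃ p ∈ tupleDecomps Xs q, Set.range p)

/-- The join of the varieties `Xs`. -/
def joinT {s : ℕ} (Xs : Fin s → Set (PS k n)) : Set (PS k n) :=
  closure {q | ∃ p : Fin s → PS k n, (∀ i, p i ∈ Xs i) ∧ memSpan q (Set.range p)}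

/-- Relation `q = F(p)` for a tuple `F` of homogeneous polynomials of the same degree. -/
def polyMapRel {N M : ℕ} (F : Fin M → MvPolynomial (Fin N) k) (p : PS k N) (q : PS k M) :
    Prop :=
  q.submodule = Submodule.span k {fun j => eval p.rep (F j)}

/-- `A` and `B` are isomorphic via mutually inverse polynomial maps. -/
def IsPolyIso {N M : ℕ} (A : Set (PS k N)) (B : Set (PS k M)) : Prop :=
  ∃ (d e : ℕ) (F : Fin M → MvPolynomial (Fin N) k) (G : Fin N → MvPolynomial (Fin M) k),
    (∀ j, (F j).IsHomogeneous d) ∧ (∀ i, (G i).IsHomogeneous e) ∧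
    (∀ p ∈ A, ∃ q ∈ B, polyMapRel F p q ∧ polyMapRel G q p) ∧
    (∀ q ∈ B, ∃ p ∈ A, polyMapRel F p q ∧ polyMapRel G q p)

/-- `A` and `B` are birational: polynomially isomorphic on dense open subsets. -/
def Birational (A B : Set (PS k n)) : Prop :=
  ∃ U V : Set (PS k n), IsOpen U ∧ IsOpen V ∧
    A ⊆ closure (A ∩ U) ∧ B ⊆ closure (B ∩ V) ∧ IsPolyIso (A ∩ U) (B ∩ V)

/-- A finite set `S` imposes independent conditions on hypersurfaces of degree `i`. -/
def ImposesIndep (S : Finset (PS k n)) (i : ℕ) : Prop :=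
  Function.Surjective (fun f : ↥(homogeneousSubmodule (Fin n) k i) =>
    fun p : ↥(↑S : Set (PS k n)) => eval (↑p : PS k n).rep (↑f : MvPolynomial (Fin n) k))

end EL

/-- If the image of the zero locus of `I` under the polynomial map `φ` is Zariski dense in affine
space, then it contains a nonempty principal open set. -/
theorem exists_forall_eval_ne_zero_exists_mem_zeroLocus {k σ τ : Type} [Field k] [IsAlgClosed k]
    [Finite σ] [Finite τ] (I : Ideal (MvPolynomial σ k))
    (φ : MvPolynomial τ k →ₐ[k] MvPolynomial σ k)
    (h : ∀ f, (∀ x ∈ zeroLocus k I, eval x (φ f) = 0) → f = 0) :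
    ∃ f : MvPolynomial τ k, f ≠ 0 ∧
      ∀ y, eval y f ≠ 0 → ∃ x ∈ zeroLocus k I, ∀ j, eval x (φ (X j)) = y j := by
  let ψ : MvPolynomial τ k →+* MvPolynomial σ k ⧸ I := (Ideal.Quotient.mk I).comp φ.toRingHom
  have hker : RingHom.ker ψ = ⊥ := by
    rw [eq_bot_iff]
    intro f hf
    refine h f fun x hx ↦ ?_
    have : φ f ∈ I := Ideal.Quotient.eq_zero_iff_mem.mp hf
    simpa [aeval_eq_eval] using hx _ this
  have hfp : ψ.FinitePresentation := by
    rw [← RingHom.FinitePresentation.of_finiteType]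
    refine RingHom.FiniteType.of_comp_finiteType (f := (C : k →+* MvPolynomial τ k)) ?_
    have : ψ.comp C = algebraMap k (MvPolynomial σ k ⧸ I) :=
      RingHom.ext fun a ↦ congrArg (Ideal.Quotient.mk I) (φ.commutes a)
    rw [this, RingHom.finiteType_algebraMap]
    infer_instance
  obtain ⟨S, hS⟩ := PrimeSpectrum.exists_constructibleSetData_iff.mpr
    (PrimeSpectrum.isConstructible_range_comap hfp)
  have hgen : (⟨⊥, Ideal.isPrime_bot⟩ : PrimeSpectrum (MvPolynomial τ k)) ∈
      Set.range (PrimeSpectrum.comap ψ) := by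
    refine (PrimeSpectrum.denseRange_comap_iff_minimalPrimes ψ).mp ?_ ⊥ ?_
    · rw [PrimeSpectrum.denseRange_comap_iff_ker_le_nilRadical, hker]
      exact bot_le
    · rw [IsDomain.minimalPrimes_eq_singleton_bot]
      rfl
  rw [← hS] at hgen
  obtain ⟨D, hDS, hD⟩ := Set.mem_iUnion₂.mp hgen
  have hg : ∀ i, D.g i = 0 := fun i ↦ by simpa using hD.1 ⟨i, rfl⟩
  refine ⟨D.f, fun hf ↦ hD.2 (by simp [hf]), fun y hy ↦ ?_⟩
  have hmem : (pointToPoint y : PrimeSpectrum (MvPolynomial τ k)) ∈ S.toSet := by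
    refine Set.mem_iUnion₂.mpr ⟨D, hDS, ?_, ?_⟩
    · rintro _ ⟨i, rfl⟩
      simp [hg i]
    · intro hm
      have : D.f ∈ vanishingIdeal k {y} := hm (Set.mem_singleton _)
      rw [mem_vanishingIdeal_singleton_iff, aeval_eq_eval] at this
      exact hy this
  rw [hS] at hmem
  obtain ⟨P, hP⟩ := hmem
  obtain ⟨M, hM, hPM⟩ := Ideal.exists_le_maximal P.asIdeal P.isPrime.ne_top
  have hcomap : vanishingIdeal k {y} ≤ M.comap ψ := by
    have : P.asIdeal.comap ψ = vanishingIdeal k {y} := congrArg PrimeSpectrum.asIdeal hP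
    rw [← this]
    exact Ideal.comap_mono hPM
  obtain ⟨x, hx⟩ := isMaximal_iff_eq_vanishingIdeal_singleton.mp
    (Ideal.comap_isMaximal_of_surjective (Ideal.Quotient.mk I) Ideal.Quotient.mk_surjective
      (K := M))
  refine ⟨x, fun p hp ↦ ?_, fun j ↦ ?_⟩
  · rw [← mem_vanishingIdeal_singleton_iff, ← hx, Ideal.mem_comap,
      Ideal.Quotient.eq_zero_iff_mem.mpr hp]
    exact M.zero_mem
  · have h1 : X j - C (y j) ∈ vanishingIdeal k {y} := by
      simp
    have h2 : φ (X j - C (y j)) ∈ M.comap (Ideal.Quotient.mk I) := hcomap h1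
    rw [hx, mem_vanishingIdeal_singleton_iff, aeval_eq_eval] at h2
    simpa [sub_eq_zero, ← MvPolynomial.algebraMap_eq] using h2

namespace EL

variable {k : Type} [Field k] {n : ℕ}

theorem eval_smul_of_isHomogeneous {f : MvPolynomial (Fin n) k} {d : ℕ} (hf : f.IsHomogeneous d)
    (t : k) (v : Fin n → k) : eval (t • v) f = t ^ d * eval v f := by
  rw [eval_eq, eval_eq, Finset.mul_sum]
  refine Finset.sum_congr rfl fun m hm ↦ ?_
  have hd : ∑ i ∈ m.support, m i = d := by
    rw [← hf (mem_support_iff.mp hm)]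
    exact DFunLike.congr_fun Finsupp.degree_eq_weight_one m
  simp only [Pi.smul_apply, smul_eq_mul, mul_pow, Finset.prod_mul_distrib,
    Finset.prod_pow_eq_pow_sum, hd]
  ring

theorem mk_mem_V0_iff {f : MvPolynomial (Fin n) k} {d : ℕ} (hf : f.IsHomogeneous d)
    {v : Fin n → k} (hv : v ≠ 0) : Projectivization.mk k v hv ∈ V0 f ↔ eval v f = 0 := by
  refine ⟨fun h ↦ h v hv rfl, fun h w hw hwv ↦ ?_⟩
  obtain ⟨a, rfl⟩ := (Projectivization.mk_eq_mk_iff' k w v hw hv).mp hwv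
  rw [eval_smul_of_isHomogeneous hf, h, mul_zero]

theorem isClosed_V0 {f : MvPolynomial (Fin n) k} {d : ℕ} (hf : f.IsHomogeneous d) :
    IsClosed (V0 f) :=
  ⟨TopologicalSpace.isOpen_generateFrom_of_mem ⟨d, f, hf, rfl⟩⟩

theorem exists_compl_V0_subset_of_isOpen {U : Set (PS k n)} (hU : IsOpen U) {p : PS k n}
    (hp : p ∈ U) :
    ∃ (d : ℕ) (f : MvPolynomial (Fin n) k), f.IsHomogeneous d ∧ p ∉ V0 f ∧ (V0 f)ᶜ ⊆ U := by
  induction hU generalizing p with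
  | basic s hs =>
    obtain ⟨d, f, hf, rfl⟩ := hs
    exact ⟨d, f, hf, hp, subset_rfl⟩
  | univ =>
    refine ⟨0, 1, isHomogeneous_one _ _, fun h ↦ ?_, Set.subset_univ _⟩
    simpa using h p.rep p.rep_nonzero p.mk_rep
  | inter s t _ _ ihs iht =>
    obtain ⟨d, f, hf, hpf, hfs⟩ := ihs hp.1
    obtain ⟨e, g, hg, hpg, hgt⟩ := iht hp.2
    refine ⟨d + e, f * g, hf.mul hg, ?_, fun q hq ↦ ⟨hfs fun h ↦ hq ?_, hgt fun h ↦ hq ?_⟩⟩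
    · induction p using Projectivization.ind with | h v hv
      rw [mk_mem_V0_iff hf] at hpf
      rw [mk_mem_V0_iff hg] at hpg
      rw [mk_mem_V0_iff (hf.mul hg), map_mul]
      exact mul_ne_zero hpf hpg
    · intro v hv hvq
      rw [map_mul, h v hv hvq, zero_mul]
    · intro v hv hvq
      rw [map_mul, h v hv hvq, mul_zero]
  | sUnion S _ ih =>
    obtain ⟨s, hs, hps⟩ := hp
    obtain ⟨d, f, hf, hpf, hfs⟩ := ih s hs hps
    exact ⟨d, f, hf, hpf, hfs.trans (Set.subset_sUnion_of_mem hs)⟩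

theorem mk_mem_linSet_iff {W : Submodule k (Fin n → k)} {v : Fin n → k} (hv : v ≠ 0) :
    Projectivization.mk k v hv ∈ linSet W ↔ v ∈ W := by
  simp [linSet, Submodule.span_singleton_le_iff_mem]

theorem isClosed_linSet (W : Submodule k (Fin n → k)) : IsClosed (linSet W) := by
  let F : Module.Dual k (Fin n → k) → MvPolynomial (Fin n) k :=
    fun φ ↦ ∑ i, C (φ (Pi.single i 1)) * X i
  have hF : ∀ φ, (F φ).IsHomogeneous 1 := fun φ ↦ IsHomogeneous.sum _ _ _ fun i _ ↦ by
    simpa using (isHomogeneous_C (Fin n) (φ (Pi.single i 1))).mul (isHomogeneous_X k i)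
  have hFe : ∀ φ v, eval v (F φ) = φ v := fun φ v ↦ by
    rw [LinearMap.pi_apply_eq_sum_univ φ v]
    simp only [F, map_sum, map_mul, eval_C, eval_X, smul_eq_mul]
    exact Finset.sum_congr rfl fun i _ ↦ by
      rw [mul_comm]
      congr 2
      ext j
      simp [Pi.single_apply, eq_comm]
  have : linSet W = ⋂ φ ∈ W.dualAnnihilator, V0 (F φ) := by
    ext p
    induction p using Projectivization.ind with | h v hv
    simp only [Set.mem_iInter, mk_mem_linSet_iff, mk_mem_V0_iff (hF _), hFe]
    rw [← Submodule.mem_dualCoannihilator, Subspace.dualAnnihilator_dualCoannihilator_eq]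
  rw [this]
  exact isClosed_biInter fun φ _ ↦ isClosed_V0 (hF φ)

theorem isPreirreducible_linSet [Infinite k] (W : Submodule k (Fin n → k)) :
    IsPreirreducible (linSet W) := by
  rintro U V hU hV ⟨p, hpW, hpU⟩ ⟨q, hqW, hqV⟩
  obtain ⟨d, f, hf, hpf, hfU⟩ := exists_compl_V0_subset_of_isOpen hU hpU
  obtain ⟨e, g, hg, hqg, hgV⟩ := exists_compl_V0_subset_of_isOpen hV hqV
  induction p using Projectivization.ind with | h a ha
  induction q using Projectivization.ind with | h b hb
  rw [mk_mem_linSet_iff] at hpW hqW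
  rw [mk_mem_V0_iff hf] at hpf
  rw [mk_mem_V0_iff hg] at hqg
  obtain ⟨i, hi⟩ := Function.ne_iff.mp ha
  -- the restriction of a polynomial to the affine line through `a` and `b`
  let res : MvPolynomial (Fin n) k → Polynomial k :=
    fun h ↦ aeval (fun j ↦ Polynomial.C (a j) + Polynomial.X * Polynomial.C (b j - a j)) h
  have hres : ∀ h t, (res h).eval t = eval (a + t • (b - a)) h := fun h t ↦ by
    change (Polynomial.evalRingHom t) (aeval _ h) = _
    rw [aeval_def, eval₂_comp_left, ← eval₂_id]
    congr 1
    · ext; simp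
    · ext; simp
  have hfg : res (f * X i) * res g ≠ 0 := by
    refine mul_ne_zero (fun h ↦ ?_) (fun h ↦ ?_)
    · have := hres (f * X i) 0
      simp [h, hpf] at this
      exact hi this
    · have := hres g 1
      simp [h] at this
      exact hqg this.symm
  obtain ⟨t, ht⟩ : ∃ t, (res (f * X i) * res g).eval t ≠ 0 := by
    by_contra! h
    exact hfg (Polynomial.funext fun t ↦ by simpa using h t)
  rw [Polynomial.eval_mul, hres, hres, map_mul, eval_X] at ht
  have hw : a + t • (b - a) ≠ 0 :=
    fun h ↦ right_ne_zero_of_mul (left_ne_zero_of_mul ht) (congrFun h i)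
  refine ⟨Projectivization.mk k _ hw, ?_, hfU ?_, hgV ?_⟩
  · rw [mk_mem_linSet_iff]
    exact W.add_mem hpW (W.smul_mem _ (W.sub_mem hqW hpW))
  · rw [Set.mem_compl_iff, mk_mem_V0_iff hf]
    exact left_ne_zero_of_mul (left_ne_zero_of_mul ht)
  · rw [Set.mem_compl_iff, mk_mem_V0_iff hg]
    exact right_ne_zero_of_mul ht

theorem linSet_top : linSet (⊤ : Submodule k (Fin n → k)) = Set.univ :=
  Set.eq_univ_of_forall fun _ ↦ le_top (α := Submodule k (Fin n → k))

instance [Infinite k] : PreirreducibleSpace (PS k n) :=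
  ⟨linSet_top (k := k) (n := n) ▸ isPreirreducible_linSet ⊤⟩

theorem eq_zero_of_V0_eq_univ [Infinite k] [Nonempty (PS k n)] {f : MvPolynomial (Fin n) k} {d : ℕ}
    (hf : f.IsHomogeneous d) (h : V0 f = Set.univ) : f = 0 := by
  have hne : ∀ v : Fin n → k, v ≠ 0 → eval v f = 0 := fun v hv ↦
    (mk_mem_V0_iff hf hv).mp (h ▸ Set.mem_univ _)
  refine MvPolynomial.funext fun v ↦ ?_
  rw [map_zero]
  by_cases hv : v = 0
  · obtain ⟨p⟩ := ‹Nonempty (PS k n)›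
    rw [hv, ← zero_smul k p.rep, eval_smul_of_isHomogeneous hf, hne _ p.rep_nonzero, mul_zero]
  · exact hne v hv

theorem eval_homogeneousComponent_eq_zero [Infinite k] {f : MvPolynomial (Fin n) k}
    {v : Fin n → k} (h : ∀ t : k, t ≠ 0 → eval (t • v) f = 0) (d : ℕ) :
    eval v (homogeneousComponent d f) = 0 := by
  let P : Polynomial k := ∑ i ∈ Finset.range (f.totalDegree + 1),
    Polynomial.monomial i (eval v (homogeneousComponent i f))
  have hP : ∀ t, P.eval t = eval (t • v) f := fun t ↦ by
    conv_rhs => rw [← sum_homogeneousComponent f]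
    simp only [P, Polynomial.eval_finsetSum, Polynomial.eval_monomial, map_sum,
      eval_smul_of_isHomogeneous (homogeneousComponent_isHomogeneous _ _)]
    exact Finset.sum_congr rfl fun i _ ↦ mul_comm _ _
  have hP0 : P = 0 := by
    refine Polynomial.eq_zero_of_infinite_isRoot P
      ((Set.finite_singleton (0 : k)).infinite_compl.mono fun t ht ↦ ?_)
    exact (hP t).trans (h t ht)
  by_cases hd : d ≤ f.totalDegree
  · have := congrArg (fun Q ↦ Q.coeff d) hP0
    simpa [P, Polynomial.finsetSum_coeff, Polynomial.coeff_monomial, hd] using this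
  · rw [homogeneousComponent_eq_zero _ _ (not_le.mp hd), map_zero]

theorem eval_eq_zero_of_mem_homogCut {X : Set (PS k n)} {f : MvPolynomial (Fin n) k}
    (hf : f ∈ homogCut X) {v : Fin n → k} (hv : v ≠ 0) (hvX : Projectivization.mk k v hv ∈ X) :
    eval v f = 0 :=
  hf.2 hvX v hv rfl

theorem eval_zero_of_mem_homogCut {X : Set (PS k n)} (hX : X.Nonempty)
    {f : MvPolynomial (Fin n) k} (hf : f ∈ homogCut X) : eval 0 f = 0 := by
  obtain ⟨p, hp⟩ := hX
  obtain ⟨d, hd⟩ := hf.1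
  rw [← zero_smul k p.rep, eval_smul_of_isHomogeneous hd,
    eval_eq_zero_of_mem_homogCut hf p.rep_nonzero (p.mk_rep.symm ▸ hp), mul_zero]

theorem mk_mem_of_forall_homogCut {X : Set (PS k n)} (hX : IsClosed X) {v : Fin n → k} (hv : v ≠ 0)
    (h : ∀ f ∈ homogCut X, eval v f = 0) : Projectivization.mk k v hv ∈ X := by
  by_contra hvX
  obtain ⟨d, f, hf, hvf, hfX⟩ := exists_compl_V0_subset_of_isOpen hX.isOpen_compl hvX
  exact hvf ((mk_mem_V0_iff hf hv).mpr (h f ⟨⟨d, hf⟩, Set.compl_subset_compl.mp hfX⟩))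

/-- A point spanned by `s` points of a set is the sum of `s` vectors of its affine cone. -/
theorem hasDecomp.exists_sum_eq {X : Set (PS k n)} {s : ℕ} {v : Fin n → k} {hv : v ≠ 0}
    (h : hasDecomp X (Projectivization.mk k v hv) s) :
    ∃ w : Fin s → Fin n → k, (∀ j (hj : w j ≠ 0), Projectivization.mk k (w j) hj ∈ X) ∧
      ∑ j, w j = v := by
  obtain ⟨A, hAX, rfl, hA⟩ := h
  have hvA : v ∈ ⨆ p ∈ A, p.submodule := hA (Submodule.mem_span_singleton_self v)
  rw [Submodule.mem_iSup_finset_iff_exists_sum] at hvA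
  obtain ⟨μ, hμ⟩ := hvA
  refine ⟨fun j ↦ μ (A.equivFin.symm j), fun j hj ↦ ?_, ?_⟩
  · let p : PS k n := (A.equivFin.symm j).1
    have hpX : p ∈ X := hAX (A.equivFin.symm j).2
    have hp : (μ p : Fin n → k) ∈ Submodule.span k {p.rep} := p.submodule_eq.le (μ p).2
    obtain ⟨a, ha⟩ := Submodule.mem_span_singleton.mp hp
    rw [show Projectivization.mk k _ hj = p from
      ((Projectivization.mk_eq_mk_iff' k _ _ hj p.rep_nonzero).mpr ⟨a, ha⟩).trans p.mk_rep]
    exact hpX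
  · rw [← hμ, ← Finset.sum_coe_sort A, ← A.equivFin.symm.sum_comp]

/-- A point that is the sum of `s` vectors of the affine cone over a set is spanned by at most `s`
points of the set. -/
theorem exists_hasDecomp_le_of_sum_eq {X : Set (PS k n)} {s : ℕ} {v : Fin n → k} (hv : v ≠ 0)
    {w : Fin s → Fin n → k} (hw : ∀ j (hj : w j ≠ 0), Projectivization.mk k (w j) hj ∈ X)
    (hsum : ∑ j, w j = v) : ∃ t ≤ s, hasDecomp X (Projectivization.mk k v hv) t := by
  classical
  let J : Finset (Fin s) := {j | w j ≠ 0}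
  have hJ : ∀ j ∈ J, w j ≠ 0 := fun j hj ↦ by simpa [J] using hj
  let A : Finset (PS k n) := J.attach.image fun j ↦ Projectivization.mk k (w j.1) (hJ j.1 j.2)
  refine ⟨A.card, ?_, A, ?_, rfl, ?_⟩
  · refine Finset.card_image_le.trans ?_
    rw [Finset.card_attach]
    exact (Finset.card_le_univ J).trans (Fintype.card_fin s).le
  · intro p hp
    obtain ⟨j, -, rfl⟩ := Finset.mem_image.mp hp
    exact hw _ _
  · rw [memSpan, Projectivization.submodule_mk, Submodule.span_singleton_le_iff_mem, ← hsum]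
    refine Submodule.sum_mem _ fun j _ ↦ ?_
    by_cases hj : w j = 0
    · rw [hj]
      exact Submodule.zero_mem _
    · have hA : Projectivization.mk k (w j) hj ∈ (A : Set (PS k n)) :=
        Finset.mem_image.mpr ⟨⟨j, by simpa [J] using hj⟩, Finset.mem_attach _ _, rfl⟩
      exact Submodule.mem_iSup_of_mem _
        (Submodule.mem_iSup_of_mem hA (Submodule.mem_span_singleton_self _))

/-- If the `s`-th secant variety fills the ambient space, then the points spanned by at most `s`
points contain a nonempty open set. -/
theorem exists_isOpen_forall_hasDecomp_le [IsAlgClosed k] {X : Set (PS k n)} (hX : IsClosed X)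
    (hne : X.Nonempty) {s : ℕ} (hs : secant X s = Set.univ) :
    ∃ U : Set (PS k n), IsOpen U ∧ U.Nonempty ∧ ∀ q ∈ U, ∃ t ≤ s, hasDecomp X q t := by
  have : Infinite k := IsAlgClosed.instInfinite
  have : Nonempty (PS k n) := hne.to_type
  let I : Ideal (MvPolynomial (Fin s × Fin n) k) :=
    Ideal.span {g | ∃ j, ∃ f ∈ homogCut X, g = rename (Prod.mk j) f}
  have hI : ∀ x, x ∈ zeroLocus k I ↔ ∀ j, ∀ f ∈ homogCut X, eval (fun i ↦ x (j, i)) f = 0 := by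
    intro x
    rw [zeroLocus_span]
    refine ⟨fun h j f hf ↦ ?_, ?_⟩
    · have := h _ ⟨j, f, hf, rfl⟩
      rwa [aeval_rename, aeval_eq_eval] at this
    · rintro h _ ⟨j, f, hf, rfl⟩
      rw [aeval_rename, aeval_eq_eval]
      exact h j f hf
  let φ : MvPolynomial (Fin n) k →ₐ[k] MvPolynomial (Fin s × Fin n) k :=
    aeval fun i ↦ ∑ j, MvPolynomial.X (j, i)
  have hφ : ∀ x f, eval x (φ f) = eval (∑ j, fun i ↦ x (j, i)) f := by
    intro x f
    rw [aeval_def, eval₂_comp_left, ← eval₂_id]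
    congr 1
    · ext; simp
    · ext; simp
  obtain ⟨f, hf0, hf⟩ := exists_forall_eval_ne_zero_exists_mem_zeroLocus I φ (by
    intro f hf
    have hV : ∀ d, V0 (homogeneousComponent d f) = Set.univ := by
      intro d
      have hd := homogeneousComponent_isHomogeneous d f
      rw [Set.eq_univ_iff_forall]
      rw [← Set.univ_subset_iff] at hs
      refine fun q ↦ closure_minimal ?_ (isClosed_V0 hd) (hs (Set.mem_univ q))
      intro p hp
      induction p using Projectivization.ind with | h v hv
      rw [mk_mem_V0_iff hd]
      refine eval_homogeneousComponent_eq_zero (fun t ht ↦ ?_) d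
      have hmk : Projectivization.mk k (t • v) (smul_ne_zero ht hv) = Projectivization.mk k v hv :=
        (Projectivization.mk_eq_mk_iff' k _ _ _ _).mpr ⟨t, rfl⟩
      rw [← hmk] at hp
      obtain ⟨w, hwX, hw⟩ := hasDecomp.exists_sum_eq hp
      rw [← hw, ← hf (fun a ↦ w a.1 a.2) ((hI _).mpr fun j g hg ↦ ?_), hφ]
      change eval (w j) g = 0
      by_cases hj : w j = 0
      · rw [hj]
        exact eval_zero_of_mem_homogCut hne hg
      · exact eval_eq_zero_of_mem_homogCut hg hj (hwX j hj)
    rw [← sum_homogeneousComponent f]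
    exact Finset.sum_eq_zero fun d _ ↦
      eq_zero_of_V0_eq_univ (homogeneousComponent_isHomogeneous d f) (hV d))
  obtain ⟨d, hd⟩ : ∃ d, homogeneousComponent d f ≠ 0 := by
    by_contra! h
    exact hf0 (by rw [← sum_homogeneousComponent f]; exact Finset.sum_eq_zero fun d _ ↦ h d)
  have hdh := homogeneousComponent_isHomogeneous d f
  refine ⟨(V0 (homogeneousComponent d f))ᶜ, (isClosed_V0 hdh).isOpen_compl, ?_, fun q hq ↦ ?_⟩
  · rw [Set.nonempty_compl]
    exact fun h ↦ hd (eq_zero_of_V0_eq_univ hdh h)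
  · induction q using Projectivization.ind with | h v hv
    rw [Set.mem_compl_iff, mk_mem_V0_iff hdh] at hq
    obtain ⟨t, ht, htf⟩ : ∃ t : k, t ≠ 0 ∧ eval (t • v) f ≠ 0 := by
      by_contra! h
      exact hq (eval_homogeneousComponent_eq_zero h d)
    obtain ⟨x, hxI, hx⟩ := hf _ htf
    have hmk : Projectivization.mk k (t • v) (smul_ne_zero ht hv) = Projectivization.mk k v hv :=
      (Projectivization.mk_eq_mk_iff' k _ _ _ _).mpr ⟨t, rfl⟩
    rw [← hmk]
    refine exists_hasDecomp_le_of_sum_eq _ (w := fun j i ↦ x (j, i))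
      (fun j hj ↦ mk_mem_of_forall_homogCut hX hj ((hI x).mp hxI j)) ?_
    ext i
    rw [← hx i, hφ, eval_X]

theorem pspan_eq_span (S : Set (PS k n)) :
    pspan S = Submodule.span k (Projectivization.rep '' S) := by
  simp only [pspan, Projectivization.submodule_eq]
  rw [Submodule.span_eq_iSup_of_singleton_spans, iSup_image]

theorem exists_forall_hasDecomp_of_nondeg {X : Set (PS k n)} (hX : Nondeg X) :
    ∃ s, ∀ q, hasDecomp X q s := by
  classical
  obtain ⟨B, hBX, hB⟩ := (Submodule.fg_span_iff_fg_span_finset_subset _).mp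
    (IsNoetherian.noetherian (Submodule.span k (Projectivization.rep '' X)))
  obtain ⟨A, hAX, rfl⟩ := Finset.subset_set_image_iff.mp hBX
  refine ⟨A.card, fun q ↦ ⟨A, hAX, rfl, ?_⟩⟩
  have : pspan (A : Set (PS k n)) = ⊤ := by
    rw [pspan_eq_span, ← Finset.coe_image, ← hB, ← pspan_eq_span, show pspan X = ⊤ from hX]
  rw [memSpan, this]
  exact le_top

theorem exists_mem_decomps {X : Set (PS k n)} (hX : Nondeg X) (q : PS k n) :
    (decomps X q).Nonempty := by
  obtain ⟨s, hs⟩ := exists_forall_hasDecomp_of_nondeg hX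
  obtain ⟨A, hAX, hAc, hA⟩ := Nat.sInf_mem (s := {s | hasDecomp X q s}) ⟨s, hs q⟩
  refine ⟨A, hAX, hAc, hA, fun B hB hqB ↦ ?_⟩
  have hlt := Finset.card_lt_card hB
  have hle : sInf {s | hasDecomp X q s} ≤ B.card :=
    Nat.sInf_le ⟨B, (Finset.coe_subset.mpr hB.subset).trans hAX, rfl, hqB⟩
  omega

theorem entryLocus_subset {X : Set (PS k n)} (hX : IsClosed X) (q : PS k n) :
    entryLocus X q ⊆ X :=
  closure_minimal (Set.iUnion₂_subset fun _ hA ↦ hA.1) hX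

theorem pspan_mono {S T : Set (PS k n)} (h : S ⊆ T) : pspan S ≤ pspan T :=
  biSup_mono h

theorem hasDecomp.mono {X Y : Set (PS k n)} (h : X ⊆ Y) {q : PS k n} {s : ℕ}
    (hq : hasDecomp X q s) : hasDecomp Y q s :=
  let ⟨A, hAX, hA⟩ := hq
  ⟨A, hAX.trans h, hA⟩

theorem secant_mono {X Y : Set (PS k n)} (h : X ⊆ Y) (s : ℕ) : secant X s ⊆ secant Y s :=
  closure_mono fun _ hq ↦ hq.mono h

theorem secant_subset_linSet (X : Set (PS k n)) (s : ℕ) : secant X s ⊆ linSet (pspan X) :=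
  closure_minimal (fun _ ⟨_, hAX, _, hA⟩ ↦ hA.trans (pspan_mono hAX)) (isClosed_linSet _)

/-- The entry locus of `q` computes the rank of `q`. -/
theorem hasDecomp_entryLocus {X : Set (PS k n)} (hX : Nondeg X) (q : PS k n) :
    hasDecomp (entryLocus X q) q (rk X q) := by
  obtain ⟨A, hA⟩ := exists_mem_decomps hX q
  exact ⟨A, (Set.subset_biUnion_of_mem (u := fun A : Finset (PS k n) ↦ (A : Set (PS k n)))
    hA).trans subset_closure, hA.2.1, hA.2.2.1⟩

/-- A general point has rank equal to the generic rank, and does not lie on the smaller secant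
varieties. -/
theorem generic_rk_eq_rgen [IsAlgClosed k] {X : Set (PS k n)} (hX : IsClosed X) (hne : X.Nonempty)
    (hnd : Nondeg X) : Generic fun q ↦ rk X q = rgen X ∧ ∀ s < rgen X, q ∉ secant X s := by
  have : Infinite k := IsAlgClosed.instInfinite
  have hlin : linSet (pspan X) = Set.univ := by rw [show pspan X = ⊤ from hnd, linSet_top]
  have hg : secant X (rgen X) = linSet (pspan X) := by
    obtain ⟨s, hs⟩ := exists_forall_hasDecomp_of_nondeg hnd
    refine Nat.sInf_mem (s := {s | secant X s = linSet (pspan X)}) ⟨s, ?_⟩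
    exact hlin ▸ Set.eq_univ_of_forall fun q ↦ subset_closure (hs q)
  obtain ⟨U, hUo, hUne, hU⟩ := exists_isOpen_forall_hasDecomp_le hX hne (hg.trans hlin)
  let 𝒮 : Set (Set (PS k n)) := (fun s ↦ (secant X s)ᶜ) '' Set.Iio (rgen X)
  have hfin : 𝒮.Finite := (Set.finite_Iio _).image _
  have hopen : ∀ V ∈ 𝒮, IsOpen V := by
    rintro _ ⟨s, -, rfl⟩
    exact isClosed_closure.isOpen_compl
  have hdense : ∀ V ∈ 𝒮, Dense V := by
    intro V hV
    refine (hopen V hV).dense ?_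
    obtain ⟨s, hs, rfl⟩ := hV
    rw [Set.nonempty_compl, ← hlin]
    exact Nat.notMem_of_lt_sInf (s := {s | secant X s = linSet (pspan X)}) hs
  refine ⟨U ∩ ⋂₀ 𝒮, hUo.inter (hfin.isOpen_sInter hopen),
    (hUo.dense hUne).inter_of_isOpen_left (hfin.dense_sInter hopen hdense) hUo, ?_⟩
  rintro q ⟨hqU, hqS⟩
  have hlt : ∀ s < rgen X, q ∉ secant X s := fun s hs ↦ hqS _ ⟨s, hs, rfl⟩
  refine ⟨?_, hlt⟩
  have hge : ∀ t, hasDecomp X q t → rgen X ≤ t := fun t ht ↦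
    not_lt.mp fun h ↦ hlt t h (subset_closure ht)
  obtain ⟨t, hts, ht⟩ := hU q hqU
  obtain rfl : t = rgen X := le_antisymm hts (hge t ht)
  exact le_antisymm (Nat.sInf_le ht) (le_csInf ⟨_, ht⟩ hge)

end EL

open EL in
/-- If `X` is of type A, then the generic rank of `X` equals the generic
rank of its general entry locus. -/
theorem statement6 {k : Type} [Field k] [IsAlgClosed k] [CharZero k]
    (r : ℕ) (X : Set (PS k (r+1))) (hX : IsVariety X) (hnd : Nondeg X)
    (hA : TypeA X) :
    Generic (fun q : PS k (r+1) => rgen X = rgen (entryLocus X q)) := by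
  have : Infinite k := IsAlgClosed.instInfinite
  obtain ⟨V, hVo, hVd, hV⟩ := generic_rk_eq_rgen hX.1 hX.2.nonempty hnd
  obtain ⟨U, hUo, hUd, hU⟩ := hA
  refine ⟨U ∩ V, hUo.inter hVo, hUd.inter_of_isOpen_left hVd hUo, ?_⟩
  rintro q ⟨hqU, hqV⟩
  have hqL : q ∈ linSet (pspan (entryLocus X q)) :=
    secant_subset_linSet _ _ (subset_closure (hasDecomp_entryLocus hnd q))
  have hirr := isPreirreducible_linSet (pspan (entryLocus X q))
  obtain ⟨O, hOo, hOd, hO⟩ := hU q hqU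
  obtain ⟨o, hoL, hoO⟩ : (linSet (pspan (entryLocus X q)) ∩ O).Nonempty :=
    closure_nonempty_iff.mp ⟨q, hOd hqL⟩
  have hmem : secant (entryLocus X q) (rgen X) = linSet (pspan (entryLocus X q)) := by
    refine (secant_subset_linSet _ _).antisymm ?_
    refine (subset_closure_inter_of_isPreirreducible_of_isOpen hirr (hOo.inter hVo)
      (hirr _ _ hOo hVo ⟨o, hoL, hoO⟩ ⟨q, hqL, hqV⟩)).trans (closure_mono ?_)
    rintro p ⟨hpL, hpO, hpV⟩
    have hp := hasDecomp_entryLocus hnd p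
    rwa [hO p ⟨hpL, hpO⟩, (hV p hpV).1] at hp
  refine le_antisymm (le_csInf ⟨_, hmem⟩ fun s hs ↦ not_lt.mp fun hlt ↦ ?_) (Nat.sInf_le hmem)
  exact (hV q hqV).2 s hlt (secant_mono (entryLocus_subset hX.1 q) s (hs ▸ hqL))
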